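/- Let m ≥ 1, let b₁, …, b_n be Hermitian matrices in M = Matrix (Fin m) (Fin m) ℂ, let τ(a) = trace(a)/m, let Ψ(a) = ((τ a).re, (τ(b₁a)).re, …, (τ(b_na)).re) ∈ ℝ^{n+1}, and let B = Ψ({a ∈ M : a is positive semidefinite and 1 − a is positive semidefinite}) be the spectral scale. Then for x ∈ extremePoints ℝ B, the point x is isolated in extremePoints ℝ B (i.e., there is ε > 0 such that every y ∈ extremePoints ℝ B with ‖y − x‖ < ε equals x) if and only if there exists a central projection p of the algebra N generated by b₁, …, b_n with Ψ(p) = x; that is, p ∈ Algebra.adjoin ℂ {b₁,…,b_n}, p is Hermitian, p·p = p, p·bᵢ = bᵢ·p for every i, and Ψ(p) = x. -/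

import Mathlib

open ComplexOrder
/-- The map `Ψ(a) = (Re τ(a), Re τ(b₁a), …, Re τ(bₙa))`, where `τ(a) = trace(a)/m`
is the normalized trace on `Matrix (Fin m) (Fin m) ℂ`. -/
noncomputable def spectralScaleMap {m n : ℕ} (b : Fin n → Matrix (Fin m) (Fin m) ℂ)
    (a : Matrix (Fin m) (Fin m) ℂ) : EuclideanSpace ℝ (Fin (n + 1)) :=
  (WithLp.equiv 2 (Fin (n + 1) → ℝ)).symm
    (Fin.cons ((a.trace / m).re) (fun j => (((b j * a).trace / m).re)))

/-- In a finite-dimensional space, the convex hull of a compact set is compact. -/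
theorem IsCompact.convexHull_of_finiteDimensional {E : Type*} [NormedAddCommGroup E]
    [NormedSpace ℝ E] [FiniteDimensional ℝ E] {s : Set E} (hs : IsCompact s) :
    IsCompact (convexHull ℝ s) := by
  have h : convexHull ℝ s = ⋃ k ∈ Finset.range (Module.finrank ℝ E + 2),
      (fun q : (Fin k → ℝ) × (Fin k → E) => ∑ i, q.1 i • q.2 i) ''
        (stdSimplex ℝ (Fin k) ×ˢ Set.univ.pi fun _ => s) := by
    apply Set.Subset.antisymm
    · intro x hx
      obtain ⟨ι, _, z, w, hz, hi, hw, hw1, rfl⟩ := eq_pos_convex_span_of_mem_convexHull hx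
      have hc : Fintype.card ι ≤ Module.finrank ℝ E + 1 :=
        hi.card_le_finrank_succ.trans
          (Nat.add_le_add_right (Submodule.finrank_le _) 1)
      let e := Fintype.equivFin ι
      simp only [Set.mem_iUnion]
      refine ⟨Fintype.card ι, Finset.mem_range.2 (by omega), (w ∘ e.symm, z ∘ e.symm),
        ⟨⟨fun i => (hw _).le, ?_⟩, fun i _ => hz ⟨_, rfl⟩⟩, ?_⟩
      · rw [← hw1]; exact Equiv.sum_comp e.symm w
      · exact Equiv.sum_comp e.symm fun i => w i • z i
    · refine Set.iUnion₂_subset fun k _ => ?_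
      rintro _ ⟨⟨w, z⟩, ⟨hw, hz⟩, rfl⟩
      exact (convex_convexHull ℝ s).sum_mem (fun i _ => hw.1 i) hw.2
        fun i _ => subset_convexHull ℝ s (hz i trivial)
  rw [h]
  refine (Finset.range _).isCompact_biUnion fun k _ => ?_
  exact ((isCompact_stdSimplex ℝ (Fin k)).prod (isCompact_univ_pi fun _ => hs)).image
    (by fun_prop)

/-- An isolated extreme point of a compact convex set in finite dimension is exposed, and it stays
exposed under small perturbations of the exposing functional. -/
theorem exists_stably_exposing_of_isolated_extremePoint {E : Type*} [NormedAddCommGroup E]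
    [NormedSpace ℝ E] [FiniteDimensional ℝ E] {B : Set E} (hB : IsCompact B) (hBc : Convex ℝ B)
    {x : E} (hx : x ∈ Set.extremePoints ℝ B) {ε : ℝ} (hε : 0 < ε)
    (hiso : ∀ y ∈ Set.extremePoints ℝ B, ‖y - x‖ < ε → y = x) :
    ∃ f : StrongDual ℝ E, ∀ g : StrongDual ℝ E, ∃ δ : ℝ, 0 < δ ∧
      ∀ y ∈ B, (f + δ • g) x ≤ (f + δ • g) y → y = x := by
  set C : Set E := B \ Metric.ball x ε with hC
  have hCc : IsCompact C := hB.diff Metric.isOpen_ball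
  have hKB : convexHull ℝ C ⊆ B := convexHull_min Set.sdiff_subset hBc
  have hxK : x ∉ convexHull ℝ C := fun h =>
    (extremePoints_convexHull_subset
      (inter_extremePoints_subset_extremePoints_of_subset hKB ⟨h, hx⟩)).2
      (Metric.mem_ball_self hε)
  obtain ⟨f, u, hfu, hux⟩ := geometric_hahn_banach_closed_point (convex_convexHull ℝ C)
    hCc.convexHull_of_finiteDimensional.isClosed hxK
  refine ⟨f, fun g => ?_⟩
  obtain ⟨R, hR⟩ := (hCc.image g.continuous).isBounded.subset_closedBall (g x)
  refine ⟨(f x - u) / (|R| + 1), div_pos (sub_pos.2 hux) (by positivity), fun y hy hxy => ?_⟩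
  set δ := (f x - u) / (|R| + 1) with hδ
  have hδ0 : 0 < δ := div_pos (sub_pos.2 hux) (by positivity)
  have hδR : δ * (|R| + 1) = f x - u := div_mul_cancel₀ _ (by positivity)
  set F := f + δ • g with hF
  have hlt : ∀ c ∈ C, F c < F x := by
    intro c hc
    have h1 := hfu c (subset_convexHull ℝ C hc)
    have h2 : |g c - g x| ≤ R := by simpa [Real.dist_eq] using hR ⟨c, hc, rfl⟩
    have h3 := (abs_le.1 (h2.trans (le_abs_self R))).2
    simp only [hF, add_apply, smul_apply, smul_eq_mul]
    nlinarith
  have hconv : Convex ℝ {y | F y < F x ∨ y = x} := by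
    rw [convex_iff_forall_pos]
    rintro y hy z hz a b ha hb hab
    have hle : ∀ {v}, F v < F x ∨ v = x → F v ≤ F x := by
      rintro v (h | rfl)
      exacts [h.le, le_rfl]
    have hb' : b = 1 - a := by linarith
    simp only [Set.mem_ofPred_eq, map_add, map_smul, smul_eq_mul] at hy hz ⊢
    rcases hy with h | rfl
    · left
      have := hle hz
      subst hb'
      nlinarith
    · rcases hz with h | rfl
      · left
        subst hb'
        nlinarith
      · right
        rw [← add_smul, hab, one_smul]
  have hsub : B ⊆ convexHull ℝ (insert x C) := by
    conv_lhs => rw [← closure_convexHull_extremePoints hB hBc]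
    refine closure_minimal (convexHull_mono fun y hy => ?_)
      (hCc.insert x).convexHull_of_finiteDimensional.isClosed
    by_cases h : y ∈ Metric.ball x ε
    · exact Or.inl (hiso y hy (by rwa [mem_ball_iff_norm] at h))
    · exact Or.inr ⟨hy.1, h⟩
  have hmem : F y < F x ∨ y = x := by
    refine convexHull_min ?_ hconv (hsub hy)
    rintro z (rfl | hz)
    exacts [Or.inr rfl, Or.inl (hlt z hz)]
  exact hmem.resolve_left (not_lt.2 hxy)

/-- The positive part of the unit ball of the algebra of square complex matrices. -/
def matrixUnitInterval (m : ℕ) : Set (Matrix (Fin m) (Fin m) ℂ) :=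
  {a | a.PosSemidef ∧ (1 - a).PosSemidef}

section

variable {m n : ℕ}

theorem convex_matrixUnitInterval : Convex ℝ (matrixUnitInterval m) := by
  rintro a ha c hc s t hs ht hst
  refine ⟨(ha.1.smul hs).add (hc.1.smul ht), ?_⟩
  have h : 1 - (s • a + t • c) = s • (1 - a) + t • (1 - c) := by
    have h1 : (1 : Matrix (Fin m) (Fin m) ℂ) = s • 1 + t • 1 := by rw [← add_smul, hst, one_smul]
    rw [smul_sub, smul_sub]
    nth_rewrite 1 [h1]
    abel
  rw [h]
  exact (ha.2.smul hs).add (hc.2.smul ht)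

theorem mem_matrixUnitInterval_of_projection {p : Matrix (Fin m) (Fin m) ℂ}
    (hp : p.IsHermitian) (hpp : p * p = p) : p ∈ matrixUnitInterval m := by
  constructor
  · have := Matrix.posSemidef_conjTranspose_mul_self p
    rwa [hp.eq, hpp] at this
  · have := Matrix.posSemidef_conjTranspose_mul_self (1 - p)
    rwa [Matrix.conjTranspose_sub, Matrix.conjTranspose_one, hp.eq, mul_sub, sub_mul, sub_mul,
      hpp, mul_one, one_mul, mul_one, sub_self, sub_zero] at this

theorem posSemidef_sub_mul_self {a : Matrix (Fin m) (Fin m) ℂ} (ha : a ∈ matrixUnitInterval m) :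
    (a - a * a).PosSemidef := by
  have h1 := ha.2.conjTranspose_mul_mul_same a
  have h2 := ha.1.conjTranspose_mul_mul_same (1 - a)
  rw [ha.1.1.eq] at h1
  rw [ha.2.1.eq] at h2
  convert h1.add h2 using 1
  noncomm_ring

theorem mul_self_mem_matrixUnitInterval {a : Matrix (Fin m) (Fin m) ℂ}
    (ha : a ∈ matrixUnitInterval m) : a * a ∈ matrixUnitInterval m := by
  constructor
  · simpa only [ha.1.1.eq] using Matrix.posSemidef_conjTranspose_mul_self a
  · convert ha.2.add (posSemidef_sub_mul_self ha) using 1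
    abel

theorem two_smul_sub_mul_self_mem_matrixUnitInterval {a : Matrix (Fin m) (Fin m) ℂ}
    (ha : a ∈ matrixUnitInterval m) : a + a - a * a ∈ matrixUnitInterval m := by
  constructor
  · convert ha.1.add (posSemidef_sub_mul_self ha) using 1
    abel
  · have h := Matrix.posSemidef_conjTranspose_mul_self (1 - a)
    rw [ha.2.1.eq] at h
    convert h using 1
    noncomm_ring

theorem unitary_conj_mem_matrixUnitInterval {a u : Matrix (Fin m) (Fin m) ℂ}
    (ha : a ∈ matrixUnitInterval m) (hu : u.conjTranspose * u = 1) :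
    u.conjTranspose * a * u ∈ matrixUnitInterval m := by
  refine ⟨ha.1.conjTranspose_mul_mul_same u, ?_⟩
  convert ha.2.conjTranspose_mul_mul_same u using 1
  rw [mul_sub, sub_mul, mul_one, hu]

theorem isCompact_matrixUnitInterval : IsCompact (matrixUnitInterval m) := by
  have hcl : IsClosed (matrixUnitInterval m) := by
    have hps : IsClosed {a : Matrix (Fin m) (Fin m) ℂ | a.PosSemidef} := by
      simp only [Matrix.posSemidef_iff_dotProduct_mulVec, Matrix.IsHermitian, Set.ofPred_and,
        Set.ofPred_forall]
      refine (isClosed_eq (by fun_prop) continuous_id).inter (isClosed_iInter fun v => ?_)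
      exact isClosed_le continuous_const (by fun_prop)
    exact hps.inter (hps.preimage (continuous_const.sub continuous_id))
  refine IsCompact.of_isClosed_subset (isCompact_univ_pi fun _ => isCompact_univ_pi fun _ =>
    isCompact_closedBall (0 : ℂ) (Real.sqrt m)) hcl ?_
  intro a ha i _ j _
  have hd := (posSemidef_sub_mul_self ha).trace_nonneg
  have h1 := ha.2.trace_nonneg
  rw [Matrix.trace_sub, Matrix.trace_one, Fintype.card_fin, sub_nonneg] at h1
  rw [Matrix.trace_sub, sub_nonneg] at hd
  have h2 : (a * a).trace = ((∑ k, ∑ l, ‖a k l‖ ^ 2 : ℝ) : ℂ) := by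
    nth_rewrite 1 [← ha.1.1.eq]
    rw [Finset.sum_comm]
    simp [Matrix.trace, Matrix.mul_apply, Complex.conj_mul']
  have h3 : ∑ k, ∑ l, ‖a k l‖ ^ 2 ≤ m := by
    have := hd.trans h1
    rw [h2] at this
    exact_mod_cast this
  have h4 : ‖a i j‖ ^ 2 ≤ ∑ k, ∑ l, ‖a k l‖ ^ 2 :=
    (Finset.single_le_sum (f := fun l => ‖a i l‖ ^ 2) (fun _ _ => by positivity)
      (Finset.mem_univ j)).trans
    (Finset.single_le_sum (f := fun k => ∑ l, ‖a k l‖ ^ 2) (fun _ _ => by positivity)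
      (Finset.mem_univ i))
  rw [mem_closedBall_zero_iff]
  exact Real.le_sqrt_of_sq_le (h4.trans h3)

theorem eq_zero_of_projection_of_trace_lt_one {e : Matrix (Fin m) (Fin m) ℂ}
    (he : e * e = e) (ht : e.trace.re < 1) : e = 0 := by
  have hid : IsIdempotentElem (Matrix.toLin' e) := by
    rw [IsIdempotentElem, Module.End.mul_eq_comp, ← Matrix.toLin'_mul, he]
  have htr := (LinearMap.IsIdempotentElem.isProj_range _ hid).trace
  rw [Matrix.trace_toLin'_eq] at htr
  have h0 : Module.finrank ℂ (LinearMap.range (Matrix.toLin' e)) = 0 := by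
    rw [htr, Complex.natCast_re] at ht
    have : Module.finrank ℂ (LinearMap.range (Matrix.toLin' e)) < 1 := by exact_mod_cast ht
    omega
  have : LinearMap.trace ℂ _ (Matrix.toLin' e) = 0 := by
    rw [Matrix.trace_toLin'_eq, htr, h0, Nat.cast_zero]
  simpa using (LinearMap.IsIdempotentElem.trace_eq_zero_iff hid).1 this

/-- The spectral projection of a Hermitian matrix `c` for `(0, ∞)` is a polynomial in `c`, and it
maximizes `a ↦ Re tr(c a)` over the positive part of the unit ball. -/
theorem exists_projection_maximizing_trace {c : Matrix (Fin m) (Fin m) ℂ} (hc : c.IsHermitian) :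
    ∃ p ∈ Algebra.adjoin ℂ {c}, p.IsHermitian ∧ p * p = p ∧
      ∀ a ∈ matrixUnitInterval m, (c * a).trace.re ≤ (c * p).trace.re := by
  classical
  set l := hc.eigenvalues
  set U : Matrix (Fin m) (Fin m) ℂ := (hc.eigenvectorUnitary : Matrix (Fin m) (Fin m) ℂ)
  have hU : star U * U = 1 := Unitary.coe_star_mul_self _
  let χ : Fin m → ℂ := fun i => if 0 < l i then 1 else 0
  have hspec : c = U * Matrix.diagonal (fun i => (l i : ℂ)) * star U := hc.spectral_theorem
  let q : Polynomial ℂ := Lagrange.interpolate (Finset.univ.image fun i => (l i : ℂ)) id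
    fun z => if 0 < z.re then 1 else 0
  have hq : ∀ i, q.eval (l i : ℂ) = χ i := fun i => by
    have := Lagrange.eval_interpolate_at_node (s := Finset.univ.image fun i => (l i : ℂ)) (v := id)
      (fun z : ℂ => if 0 < z.re then (1 : ℂ) else 0) Function.injective_id.injOn
      (Finset.mem_image_of_mem _ (Finset.mem_univ i))
    rw [id, Complex.ofReal_re] at this
    exact this
  have hqc : Polynomial.aeval c q = U * Matrix.diagonal χ * star U := by
    have h1 : Polynomial.aeval c q = U * Polynomial.aeval
        (Matrix.diagonal fun i => (l i : ℂ)) q * star U := by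
      conv_lhs => rw [hspec]
      exact Polynomial.aeval_algHom_apply
        (Unitary.conjStarAlgAut ℂ (Matrix (Fin m) (Fin m) ℂ) hc.eigenvectorUnitary).toAlgEquiv
          (Matrix.diagonal fun i => (l i : ℂ)) q
    have h2 : Polynomial.aeval (Matrix.diagonal fun i => (l i : ℂ)) q = Matrix.diagonal χ := by
      have := Polynomial.aeval_algHom_apply (Matrix.diagonalAlgHom ℂ : _ →ₐ[ℂ] _)
        (fun i => (l i : ℂ)) q
      refine this.trans (congrArg Matrix.diagonal (funext fun i => ?_))
      rw [Polynomial.aeval_pi_apply]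
      exact (congrFun (Polynomial.coe_aeval_eq_eval _) q).trans (hq i)
    rw [h1, h2]
  have htr : ∀ a, (c * a).trace.re = ∑ i, l i * ((star U * a * U) i i).re := by
    intro a
    have : (c * a).trace = (Matrix.diagonal (fun i => (l i : ℂ)) * (star U * a * U)).trace := by
      rw [hspec, mul_assoc, mul_assoc, Matrix.trace_mul_comm]
      simp only [mul_assoc]
    rw [this, Matrix.trace, Complex.re_sum]
    simp [Matrix.diagonal_mul]
  refine ⟨Polynomial.aeval c q, Polynomial.aeval_mem_adjoin_singleton ℂ c, ?_, ?_, ?_⟩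
  · rw [hqc]
    refine Matrix.isHermitian_mul_mul_conjTranspose U (Matrix.isHermitian_diagonal_iff.2 fun i => ?_)
    simp only [χ]
    split_ifs <;> simp
  · rw [hqc]
    calc U * Matrix.diagonal χ * star U * (U * Matrix.diagonal χ * star U)
        = U * (Matrix.diagonal χ * (star U * U) * Matrix.diagonal χ) * star U := by noncomm_ring
      _ = _ := by
        rw [hU, mul_one, Matrix.diagonal_mul_diagonal]
        congr! 4 with i
        simp only [χ]
        split_ifs <;> simp
  · intro a ha
    have hpos := unitary_conj_mem_matrixUnitInterval ha hU
    have hp : star U * Polynomial.aeval c q * U = Matrix.diagonal χ := by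
      rw [hqc]
      calc star U * (U * Matrix.diagonal χ * star U) * U
        = star U * U * Matrix.diagonal χ * (star U * U) := by noncomm_ring
      _ = _ := by rw [hU, mul_one, one_mul]
    rw [htr, htr, hp]
    refine Finset.sum_le_sum fun i _ => ?_
    have h0 : 0 ≤ ((star U * a * U) i i).re := (Complex.le_def.1 (hpos.1.diag_nonneg (i := i))).1
    have h1 : 0 ≤ ((1 - star U * a * U) i i).re :=
      (Complex.le_def.1 (hpos.2.diag_nonneg (i := i))).1
    rw [Matrix.sub_apply, Matrix.one_apply_eq, Complex.sub_re, Complex.one_re] at h1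
    rw [Matrix.diagonal_apply_eq]
    simp only [χ]
    split_ifs with h
    · rw [Complex.one_re]
      exact mul_le_mul_of_nonneg_left (by linarith) h.le
    · rw [Complex.zero_re, mul_zero]
      exact mul_nonpos_of_nonpos_of_nonneg (not_lt.1 h) h0

@[simp]
theorem spectralScaleMap_zero (b : Fin n → Matrix (Fin m) (Fin m) ℂ)
    (a : Matrix (Fin m) (Fin m) ℂ) : spectralScaleMap b a 0 = a.trace.re / m := by
  simp [spectralScaleMap]

@[simp]
theorem spectralScaleMap_succ (b : Fin n → Matrix (Fin m) (Fin m) ℂ)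
    (a : Matrix (Fin m) (Fin m) ℂ) (j : Fin n) :
    spectralScaleMap b a j.succ = (b j * a).trace.re / m := by
  simp [spectralScaleMap]

theorem spectralScaleMap_congr {b : Fin n → Matrix (Fin m) (Fin m) ℂ}
    {a c : Matrix (Fin m) (Fin m) ℂ} (h : a.trace = c.trace)
    (hb : ∀ j, (b j * a).trace = (b j * c).trace) :
    spectralScaleMap b a = spectralScaleMap b c := by
  ext i
  refine Fin.cases ?_ (fun j => ?_) i
  · simp [h]
  · simp [hb]

/-- `spectralScaleMap` as a real-linear map. -/
noncomputable def spectralScaleLinearMap (b : Fin n → Matrix (Fin m) (Fin m) ℂ) :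
    Matrix (Fin m) (Fin m) ℂ →ₗ[ℝ] EuclideanSpace ℝ (Fin (n + 1)) where
  toFun := spectralScaleMap b
  map_add' a c := by
    ext i
    refine Fin.cases ?_ (fun j => ?_) i
    · simp [add_div]
    · simp [mul_add, add_div]
  map_smul' r a := by
    ext i
    refine Fin.cases ?_ (fun j => ?_) i
    · simp [mul_div_assoc]
    · simp [mul_div_assoc]

theorem spectralScaleMap_add (b : Fin n → Matrix (Fin m) (Fin m) ℂ)
    (a c : Matrix (Fin m) (Fin m) ℂ) :
    spectralScaleMap b (a + c) = spectralScaleMap b a + spectralScaleMap b c :=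
  (spectralScaleLinearMap b).map_add a c

theorem spectralScaleMap_smul (b : Fin n → Matrix (Fin m) (Fin m) ℂ) (r : ℝ)
    (a : Matrix (Fin m) (Fin m) ℂ) :
    spectralScaleMap b (r • a) = r • spectralScaleMap b a :=
  (spectralScaleLinearMap b).map_smul r a

theorem continuous_spectralScaleMap (b : Fin n → Matrix (Fin m) (Fin m) ℂ) :
    Continuous (spectralScaleMap b) :=
  (spectralScaleLinearMap b).continuous_of_finiteDimensional

/-- A preimage of an extreme point of the spectral scale is a projection. -/
theorem mul_self_eq_of_spectralScaleMap_mem_extremePoints (hm : 1 ≤ m)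
    {b : Fin n → Matrix (Fin m) (Fin m) ℂ} {a : Matrix (Fin m) (Fin m) ℂ}
    (ha : a ∈ matrixUnitInterval m)
    (hx : spectralScaleMap b a ∈
      Set.extremePoints ℝ (spectralScaleMap b '' matrixUnitInterval m)) : a * a = a := by
  have h := hx.2 ⟨_, mul_self_mem_matrixUnitInterval ha, rfl⟩
    ⟨_, two_smul_sub_mul_self_mem_matrixUnitInterval ha, rfl⟩
    ⟨1 / 2, 1 / 2, by norm_num, by norm_num, by norm_num, by
      rw [← smul_add, ← spectralScaleMap_add, ← spectralScaleMap_smul]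
      congr 1
      rw [add_sub_cancel, ← two_smul ℝ a, smul_smul]
      norm_num⟩
  have hm0 : (m : ℝ) ≠ 0 := by positivity
  have h0 := congrArg (fun v : EuclideanSpace ℝ (Fin (n + 1)) => v 0) h
  simp only [spectralScaleMap_zero, div_left_inj' hm0] at h0
  have hpos := posSemidef_sub_mul_self ha
  have htr : (a - a * a).trace = 0 := by
    apply Complex.ext
    · rw [Matrix.trace_sub, Complex.sub_re, h0, sub_self, Complex.zero_re]
    · exact (Complex.le_def.1 hpos.trace_nonneg).2.symm
  exact (sub_eq_zero.1 (hpos.trace_eq_zero_iff.1 htr)).symm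

/-- Extreme points of the spectral scale have only one preimage. -/
theorem eq_of_spectralScaleMap_mem_extremePoints (hm : 1 ≤ m)
    {b : Fin n → Matrix (Fin m) (Fin m) ℂ} {a c : Matrix (Fin m) (Fin m) ℂ}
    (ha : a ∈ matrixUnitInterval m) (hc : c ∈ matrixUnitInterval m)
    (hx : spectralScaleMap b a ∈
      Set.extremePoints ℝ (spectralScaleMap b '' matrixUnitInterval m))
    (hac : spectralScaleMap b c = spectralScaleMap b a) : c = a := by
  set d := (1 / 2 : ℝ) • (a + c) with hd
  have hdm : d ∈ matrixUnitInterval m := by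
    rw [hd, smul_add]
    exact convex_matrixUnitInterval ha hc (by norm_num) (by norm_num) (by norm_num)
  have hdx : spectralScaleMap b d = spectralScaleMap b a := by
    rw [hd, spectralScaleMap_smul, spectralScaleMap_add, hac, ← two_smul ℝ, smul_smul]
    norm_num
  have ha2 := mul_self_eq_of_spectralScaleMap_mem_extremePoints hm ha hx
  have hc2 := mul_self_eq_of_spectralScaleMap_mem_extremePoints hm hc (hac ▸ hx)
  have hd2 := mul_self_eq_of_spectralScaleMap_mem_extremePoints hm hdm (hdx ▸ hx)
  have hs : a + c = d + d := by rw [hd, ← two_smul ℝ, smul_smul]; norm_num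
  have h1 : (a + c) * (a + c) = (a + c) + (a + c) := by
    rw [hs, mul_add, add_mul, hd2]
  have h2 : (c - a).conjTranspose * (c - a) = 0 := by
    rw [Matrix.conjTranspose_sub, ha.1.1.eq, hc.1.1.eq]
    calc (c - a) * (c - a)
        = (a * a + a * a) + (c * c + c * c) - (a + c) * (a + c) := by noncomm_ring
      _ = 0 := by rw [h1, ha2, hc2]; abel
  exact sub_eq_zero.1 (Matrix.conjTranspose_mul_self_eq_zero.1 h2)

/-- The preimage of an extreme point of the spectral scale commutes with every projection that
commutes with all the `b i`. -/
theorem commute_of_spectralScaleMap_mem_extremePoints (hm : 1 ≤ m)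
    {b : Fin n → Matrix (Fin m) (Fin m) ℂ} {p q : Matrix (Fin m) (Fin m) ℂ}
    (hp : p.IsHermitian) (hpp : p * p = p) (hpb : ∀ i, p * b i = b i * p)
    (hq : q ∈ matrixUnitInterval m)
    (hx : spectralScaleMap b q ∈
      Set.extremePoints ℝ (spectralScaleMap b '' matrixUnitInterval m)) : p * q = q * p := by
  set u := p + p - 1 with hu
  have huu : u * u = 1 := by
    rw [hu]
    calc (p + p - 1) * (p + p - 1) = 4 • (p * p) - 4 • p + 1 := by noncomm_ring
      _ = 1 := by rw [hpp]; abel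
  have hus : u.conjTranspose = u := by simp [hu, hp.eq]
  have hub : ∀ i, u * b i = b i * u := fun i => by
    simp only [hu, sub_mul, mul_sub, add_mul, mul_add, hpb, one_mul, mul_one]
  have hconj := unitary_conj_mem_matrixUnitInterval (u := u) hq (by rw [hus, huu])
  rw [hus] at hconj
  have h := eq_of_spectralScaleMap_mem_extremePoints hm hq hconj hx
    (spectralScaleMap_congr (by rw [Matrix.trace_mul_comm, ← mul_assoc, huu, one_mul]) fun j => by
      rw [← mul_assoc, Matrix.trace_mul_comm]
      congr 1
      rw [← mul_assoc u, ← mul_assoc, hub, mul_assoc (b j), huu, mul_one])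
  have hcomm : u * q = q * u := by
    calc u * q = u * q * u * u := by rw [mul_assoc _ u u, huu, mul_one]
      _ = q * u := by rw [h]
  have h2 : (2 : ℂ) • (p * q) = (2 : ℂ) • (q * p) := by
    simp only [hu, sub_mul, mul_sub, add_mul, mul_add, one_mul, mul_one, sub_left_inj] at hcomm
    simpa only [two_smul] using hcomm
  exact smul_right_injective _ two_ne_zero h2

/-- The matrix `c = f₀ + ∑ fⱼ bⱼ` for which `f (Ψ a) = Re τ(c a)`. -/
noncomputable def functionalMatrix (b : Fin n → Matrix (Fin m) (Fin m) ℂ)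
    (f : StrongDual ℝ (EuclideanSpace ℝ (Fin (n + 1)))) : Matrix (Fin m) (Fin m) ℂ :=
  f (EuclideanSpace.single 0 1) • 1 + ∑ j, f (EuclideanSpace.single (Fin.succ j) 1) • b j

theorem apply_spectralScaleMap (b : Fin n → Matrix (Fin m) (Fin m) ℂ)
    (f : StrongDual ℝ (EuclideanSpace ℝ (Fin (n + 1)))) (a : Matrix (Fin m) (Fin m) ℂ) :
    f (spectralScaleMap b a) = (functionalMatrix b f * a).trace.re / m := by
  have h : spectralScaleMap b a =
      ∑ i, spectralScaleMap b a i • EuclideanSpace.single i (1 : ℝ) := by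
    ext i
    simp [Finset.sum_apply, Pi.single_apply]
  rw [h, map_sum, Fin.sum_univ_succ]
  simp only [map_smul, smul_eq_mul, spectralScaleMap_zero, spectralScaleMap_succ,
    functionalMatrix, add_mul, Finset.sum_mul, Matrix.trace_add, Matrix.trace_sum, Complex.add_re,
    Complex.re_sum, add_div, Finset.sum_div, Matrix.smul_mul, Matrix.trace_smul, Complex.smul_re,
    one_mul]
  congr 1
  · ring
  · exact Finset.sum_congr rfl fun j _ => by ring

theorem isHermitian_functionalMatrix {b : Fin n → Matrix (Fin m) (Fin m) ℂ}
    (hb : ∀ i, (b i).IsHermitian) (f : StrongDual ℝ (EuclideanSpace ℝ (Fin (n + 1)))) :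
    (functionalMatrix b f).IsHermitian := by
  simp [functionalMatrix, Matrix.IsHermitian, Matrix.conjTranspose_sum, (hb _).eq]

theorem functionalMatrix_mem_adjoin (b : Fin n → Matrix (Fin m) (Fin m) ℂ)
    (f : StrongDual ℝ (EuclideanSpace ℝ (Fin (n + 1)))) :
    functionalMatrix b f ∈ Algebra.adjoin ℂ (Set.range b) := by
  have hr : ∀ (r : ℝ) (a : Matrix (Fin m) (Fin m) ℂ), a ∈ Algebra.adjoin ℂ (Set.range b) →
      r • a ∈ Algebra.adjoin ℂ (Set.range b) := fun r a ha => by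
    rw [← Complex.coe_smul]
    exact Subalgebra.smul_mem _ ha _
  exact add_mem (hr _ _ (one_mem _))
    (sum_mem fun j _ => hr _ _ (Algebra.subset_adjoin ⟨j, rfl⟩))

theorem functionalMatrix_add_smul_proj (b : Fin n → Matrix (Fin m) (Fin m) ℂ)
    (f : StrongDual ℝ (EuclideanSpace ℝ (Fin (n + 1)))) (δ : ℝ) (j : Fin n) :
    functionalMatrix b (f + δ • EuclideanSpace.proj j.succ) = functionalMatrix b f + δ • b j := by
  simp [functionalMatrix, add_smul, Finset.sum_add_distrib, add_assoc, ite_smul,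
    Fin.succ_ne_zero]

/-- If `f` attains its maximum over the spectral scale only at the extreme point `Ψ(p)`, then `p`
is a polynomial in the matrix representing `f`. -/
theorem mem_adjoin_of_exposed (hm : 1 ≤ m) {b : Fin n → Matrix (Fin m) (Fin m) ℂ}
    (hb : ∀ i, (b i).IsHermitian) {p : Matrix (Fin m) (Fin m) ℂ} (hp : p ∈ matrixUnitInterval m)
    (hx : spectralScaleMap b p ∈
      Set.extremePoints ℝ (spectralScaleMap b '' matrixUnitInterval m))
    {f : StrongDual ℝ (EuclideanSpace ℝ (Fin (n + 1)))}
    (hf : ∀ y ∈ spectralScaleMap b '' matrixUnitInterval m, f (spectralScaleMap b p) ≤ f y →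
      y = spectralScaleMap b p) :
    p ∈ Algebra.adjoin ℂ {functionalMatrix b f} := by
  obtain ⟨q, hqc, hq, hqq, hmax⟩ :=
    exists_projection_maximizing_trace (isHermitian_functionalMatrix hb f)
  have hqm := mem_matrixUnitInterval_of_projection hq hqq
  have h : q = p := by
    refine eq_of_spectralScaleMap_mem_extremePoints hm hp hqm hx (hf _ ⟨q, hqm, rfl⟩ ?_)
    rw [apply_spectralScaleMap, apply_spectralScaleMap]
    exact div_le_div_of_nonneg_right (hmax p hp) (Nat.cast_nonneg m)
  exact h ▸ hqc

end

theorem stmt11 {m n : ℕ} (hm : 1 ≤ m) (b : Fin n → Matrix (Fin m) (Fin m) ℂ)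
    (hb : ∀ i, (b i).IsHermitian)
    (B : Set (EuclideanSpace ℝ (Fin (n + 1))))
    (hB : B = spectralScaleMap b ''
      {a : Matrix (Fin m) (Fin m) ℂ | a.PosSemidef ∧ (1 - a).PosSemidef})
    (x : EuclideanSpace ℝ (Fin (n + 1))) (hx : x ∈ Set.extremePoints ℝ B) :
    (∃ ε > 0, ∀ y ∈ Set.extremePoints ℝ B, ‖y - x‖ < ε → y = x) ↔
      ∃ p : Matrix (Fin m) (Fin m) ℂ,
        p ∈ Algebra.adjoin ℂ (Set.range b) ∧ p.IsHermitian ∧ p * p = p ∧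
        (∀ i, p * b i = b i * p) ∧ spectralScaleMap b p = x := by
  change B = spectralScaleMap b '' matrixUnitInterval m at hB
  subst hB
  constructor
  · rintro ⟨ε, hε, hiso⟩
    obtain ⟨f, hf⟩ := exists_stably_exposing_of_isolated_extremePoint
      (isCompact_matrixUnitInterval.image (continuous_spectralScaleMap b))
      (convex_matrixUnitInterval.linear_image (spectralScaleLinearMap b)) hx hε hiso
    obtain ⟨p, hp, rfl⟩ := hx.1
    have hadj : ∀ g, ∃ δ : ℝ, 0 < δ ∧ p ∈ Algebra.adjoin ℂ {functionalMatrix b (f + δ • g)} :=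
      fun g => (hf g).imp fun δ hδ => ⟨hδ.1, mem_adjoin_of_exposed hm hb hp hx hδ.2⟩
    obtain ⟨δ₀, -, hp0⟩ := hadj 0
    rw [smul_zero, add_zero] at hp0
    refine ⟨p, ?_, hp.1.1, mul_self_eq_of_spectralScaleMap_mem_extremePoints hm hp hx,
      fun j => ?_, rfl⟩
    · exact Algebra.adjoin_le (Set.singleton_subset_iff.2 (functionalMatrix_mem_adjoin b f)) hp0
    · obtain ⟨δ, hδ, hpj⟩ := hadj (EuclideanSpace.proj j.succ)
      have h0 := (Algebra.commute_of_mem_adjoin_self hp0).eq.symm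
      have hj := (Algebra.commute_of_mem_adjoin_self hpj).eq.symm
      rw [functionalMatrix_add_smul_proj, mul_add, add_mul, h0, add_right_inj,
        Matrix.mul_smul, Matrix.smul_mul] at hj
      exact smul_right_injective _ hδ.ne' hj
  · rintro ⟨p, -, hp, hpp, hpb, rfl⟩
    have hpm := mem_matrixUnitInterval_of_projection hp hpp
    set Q := {q ∈ matrixUnitInterval m | 1 ≤ ((q - p) * (q - p)).trace.re} with hQ
    have hQc : IsCompact Q := isCompact_matrixUnitInterval.inter_right <|
      isClosed_le continuous_const <| Complex.continuous_re.comp <| by fun_prop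
    have hxQ : spectralScaleMap b p ∉ spectralScaleMap b '' Q := by
      rintro ⟨q, ⟨hq, hq1⟩, hqp⟩
      rw [eq_of_spectralScaleMap_mem_extremePoints hm hpm hq hx hqp] at hq1
      norm_num at hq1
    obtain ⟨ε, hε, hball⟩ := Metric.isOpen_iff.1
      (hQc.image (continuous_spectralScaleMap b)).isClosed.isOpen_compl _ hxQ
    refine ⟨ε, hε, fun y hy hyx => ?_⟩
    obtain ⟨q, hq, rfl⟩ := hy.1
    have hqQ : q ∉ Q := fun h => hball (mem_ball_iff_norm.2 hyx) ⟨q, h, rfl⟩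
    have hqq := mul_self_eq_of_spectralScaleMap_mem_extremePoints hm hq hy
    have hpq := commute_of_spectralScaleMap_mem_extremePoints hm hp hpp hpb hq hy
    have hlt : ((q - p) * (q - p)).trace.re < 1 := not_le.1 fun h => hqQ ⟨hq, h⟩
    have hsq : (q - p) * (q - p) = q + p - (2 : ℕ) • (q * p) := by
      rw [mul_sub, sub_mul, sub_mul, hpq, hqq, hpp]
      abel
    have hqp1 : q * p * (q * p) = q * p := by
      rw [mul_assoc, ← mul_assoc p q p, hpq, mul_assoc q p p, hpp, ← mul_assoc, hqq]
    have hidem : (q - p) * (q - p) * ((q - p) * (q - p)) = (q - p) * (q - p) := by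
      have e1 : q * (q * p) = q * p := by rw [← mul_assoc, hqq]
      have e2 : q * p * p = q * p := by rw [mul_assoc, hpp]
      have e3 : q * p * q = q * p := by rw [mul_assoc, hpq, e1]
      have e4 : p * (q * p) = q * p := by rw [← mul_assoc, hpq, e2]
      rw [hsq]
      simp only [mul_sub, sub_mul, mul_add, add_mul, smul_mul_assoc, mul_smul_comm, hqp1, e1, e2,
        e3, e4, hqq, hpp, hpq]
      abel
    have h0 := eq_zero_of_projection_of_trace_lt_one hidem hlt
    have hH : (q - p).conjTranspose = q - p := (hq.1.1.sub hp).eq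
    have h1 : (q - p).conjTranspose * (q - p) = 0 := by rw [hH, h0]
    rw [sub_eq_zero.1 (Matrix.conjTranspose_mul_self_eq_zero.1 h1)]
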